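/- Let p, q be primes. The map ψ_{q,p} : ℤ_p → ℤ_q is the unique function satisfying ψ_{q,p}(pz + j) = j + q·ψ_{q,p}(z) for all z ∈ ℤ_p and j ∈ {0,...,p−1} together with the rising-continuity condition ψ_{q,p}(z) = lim_{n→∞} ψ_{q,p}([z]_{p^n}) (limit in ℤ_q). Moreover ψ_{q,p} is injective if and only if p ≤ q, and surjective if and only if p ≥ q. -/

import Mathlib

open Filter Topology

/-- The space-change map `ψ_{q,p} : ℤ_p → ℤ_q`, sending `∑ d_n p^n` to `∑ d_n q^n`.
The `n`-th base-`p` digit of `z` is `z.appr (n+1) / p^n ∈ {0,...,p−1}`. -/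
noncomputable def psi (p q : ℕ) [Fact p.Prime] [Fact q.Prime] (z : ℤ_[p]) : ℤ_[q] :=
  ∑' n : ℕ, ((z.appr (n + 1) / p ^ n : ℕ) : ℤ_[q]) * (q : ℤ_[q]) ^ n

theorem aux_appr_unique {p : ℕ} [Fact p.Prime] (x : ℤ_[p]) (n a : ℕ) (ha : a < p ^ n)
    (h : x - (a : ℤ_[p]) ∈ (Ideal.span {(p : ℤ_[p]) ^ n} : Ideal ℤ_[p])) : x.appr n = a := by
  have h1 := PadicInt.zmod_congr_of_sub_mem_span n x (x.appr n) a (PadicInt.appr_spec n x) h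
  have h2 := (ZMod.natCast_eq_natCast_iff' _ _ _).1 h1
  rwa [Nat.mod_eq_of_lt (PadicInt.appr_lt x n), Nat.mod_eq_of_lt ha] at h2

theorem aux_appr_step {p : ℕ} [Fact p.Prime] (z : ℤ_[p]) (j : Fin p) (n : ℕ) :
    ((p : ℤ_[p]) * z + ((j : ℕ) : ℤ_[p])).appr (n + 1) = p * z.appr n + j := by
  apply aux_appr_unique
  · have h1 := PadicInt.appr_lt z n
    have h2 := j.2
    have h3 : p * (z.appr n + 1) ≤ p * p ^ n := Nat.mul_le_mul_left _ h1
    rw [pow_succ, mul_comm (p ^ n)]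
    rw [mul_add] at h3
    omega
  · obtain ⟨c, hc⟩ := Ideal.mem_span_singleton.1 (PadicInt.appr_spec n z)
    refine Ideal.mem_span_singleton.2 ⟨c, ?_⟩
    push_cast
    linear_combination (p : ℤ_[p]) * hc

theorem aux_exists {p : ℕ} [Fact p.Prime] (x : ℤ_[p]) :
    ∃ (z : ℤ_[p]) (j : Fin p), x = (p : ℤ_[p]) * z + ((j : ℕ) : ℤ_[p]) := by
  obtain ⟨c, hc⟩ := Ideal.mem_span_singleton.1 (PadicInt.appr_spec 1 x)
  have h := PadicInt.appr_lt x 1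
  rw [pow_one] at h hc
  exact ⟨c, ⟨x.appr 1, h⟩, by linear_combination hc⟩

theorem aux_norm_lt {q : ℕ} [Fact q.Prime] : ‖(q : ℤ_[q])‖ < 1 := by
  rw [PadicInt.norm_p]
  exact inv_lt_one_of_one_lt₀ (by exact_mod_cast (Fact.out : q.Prime).one_lt)

theorem aux_summable {q : ℕ} [Fact q.Prime] (d : ℕ → ℕ) :
    Summable (fun n => (d n : ℤ_[q]) * (q : ℤ_[q]) ^ n) := by
  refine Summable.of_norm_bounded (g := fun n => ‖(q : ℤ_[q])‖ ^ n)
    (summable_geometric_of_lt_one (norm_nonneg _) aux_norm_lt) fun n => ?_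
  rw [norm_mul, norm_pow]
  exact mul_le_of_le_one_left (by positivity) (PadicInt.norm_le_one _)

theorem aux_psi_step (p q : ℕ) [Fact p.Prime] [Fact q.Prime] (z : ℤ_[p]) (j : Fin p) :
    psi p q ((p : ℤ_[p]) * z + ((j : ℕ) : ℤ_[p]))
      = ((j : ℕ) : ℤ_[q]) + (q : ℤ_[q]) * psi p q z := by
  have hp : 0 < p := (Fact.out : p.Prime).pos
  unfold psi
  rw [(aux_summable (q := q) _).tsum_eq_zero_add, ← (aux_summable (q := q) _).tsum_mul_left]
  congr 1
  · rw [aux_appr_step]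
    simp [PadicInt.appr]
  · refine tsum_congr fun n => ?_
    rw [aux_appr_step, pow_succ' p, ← Nat.div_div_eq_div_mul, Nat.mul_add_div hp,
      Nat.div_eq_of_lt j.2, add_zero, pow_succ]
    ring

theorem aux_eq_zero {q : ℕ} [Fact q.Prime] (y : ℤ_[q]) (h : ∀ n : ℕ, (q : ℤ_[q]) ^ n ∣ y) :
    y = 0 := by
  rw [← norm_le_zero_iff]
  refine ge_of_tendsto (tendsto_pow_atTop_nhds_zero_of_lt_one (norm_nonneg (q : ℤ_[q]))
    aux_norm_lt) (Eventually.of_forall fun n => ?_)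
  obtain ⟨c, rfl⟩ := h n
  rw [norm_mul, norm_pow]
  exact mul_le_of_le_one_right (by positivity) (PadicInt.norm_le_one _)

theorem aux_unique {p q : ℕ} [Fact p.Prime] [Fact q.Prime] (f g : ℤ_[p] → ℤ_[q])
    (hf : ∀ z : ℤ_[p], ∀ j : Fin p, f ((p : ℤ_[p]) * z + ((j : ℕ) : ℤ_[p]))
            = ((j : ℕ) : ℤ_[q]) + (q : ℤ_[q]) * f z)
    (hg : ∀ z : ℤ_[p], ∀ j : Fin p, g ((p : ℤ_[p]) * z + ((j : ℕ) : ℤ_[p]))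
            = ((j : ℕ) : ℤ_[q]) + (q : ℤ_[q]) * g z) : f = g := by
  funext x
  rw [← sub_eq_zero]
  refine aux_eq_zero _ fun n => ?_
  induction n generalizing x with
  | zero => simp
  | succ n ih =>
    obtain ⟨z, j, rfl⟩ := aux_exists x
    obtain ⟨c, hc⟩ := ih z
    refine ⟨c, ?_⟩
    rw [hf, hg]
    linear_combination (q : ℤ_[q]) * hc

theorem aux_comp {p q : ℕ} [Fact p.Prime] [Fact q.Prime] (h : p ≤ q) (x : ℤ_[p]) :
    psi q p (psi p q x) = x := by
  refine congrFun (aux_unique (fun x => psi q p (psi p q x)) (fun x => x) ?_ ?_) x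
  · intro z j
    have := aux_psi_step q p (psi p q z) ⟨j, j.2.trans_le h⟩
    simp only at this ⊢
    rw [aux_psi_step, ← this, add_comm]
  · intro z j
    exact add_comm _ _

theorem aux_psi_zero (p q : ℕ) [Fact p.Prime] [Fact q.Prime] : psi p q 0 = 0 := by
  simp [psi, aux_appr_unique (p := p) 0 _ 0 (pow_pos (Fact.out : p.Prime).pos _) (by simp)]

theorem aux_psi_lt (p q : ℕ) [Fact p.Prime] [Fact q.Prime] (j : ℕ) (hj : j < p) :
    psi p q (j : ℤ_[p]) = j := by
  have := aux_psi_step p q 0 ⟨j, hj⟩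
  simpa [aux_psi_zero] using this

/-- `ψ_{q,p}` satisfies `ψ(pz+j) = j + q·ψ(z)` for all `z ∈ ℤ_p`, `j ∈ {0,...,p−1}`,
is rising-continuous (`ψ([z]_{p^n}) → ψ(z)` q-adically), and is the unique such function.
Moreover it is injective iff `p ≤ q` and surjective iff `p ≥ q`. -/
theorem stmt17 (p q : ℕ) [Fact p.Prime] [Fact q.Prime] :
    ((∀ z : ℤ_[p], ∀ j : Fin p,
        psi p q ((p : ℤ_[p]) * z + ((j : ℕ) : ℤ_[p]))
          = ((j : ℕ) : ℤ_[q]) + (q : ℤ_[q]) * psi p q z) ∧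
      (∀ z : ℤ_[p],
        Tendsto (fun n => psi p q ((z.appr n : ℕ) : ℤ_[p])) atTop (𝓝 (psi p q z)))) ∧
    (∀ f : ℤ_[p] → ℤ_[q],
      ((∀ z : ℤ_[p], ∀ j : Fin p,
          f ((p : ℤ_[p]) * z + ((j : ℕ) : ℤ_[p]))
            = ((j : ℕ) : ℤ_[q]) + (q : ℤ_[q]) * f z) ∧
        (∀ z : ℤ_[p],
          Tendsto (fun n => f ((z.appr n : ℕ) : ℤ_[p])) atTop (𝓝 (f z)))) →
      f = psi p q) ∧
    (Function.Injective (psi p q) ↔ p ≤ q) ∧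
    (Function.Surjective (psi p q) ↔ q ≤ p) := by
  refine ⟨⟨aux_psi_step p q, fun z => ?_⟩, fun f hf => aux_unique _ _ hf.1 (aux_psi_step p q),
    ⟨fun h => ?_, fun h => ?_⟩, ⟨fun h => ?_, fun h => ?_⟩⟩
  · rw [tendsto_iff_norm_sub_tendsto_zero]
    refine squeeze_zero (fun _ => norm_nonneg _) (fun n => ?_)
      (tendsto_pow_atTop_nhds_zero_of_lt_one (norm_nonneg (q : ℤ_[q])) aux_norm_lt)
    have key : (q : ℤ_[q]) ^ n ∣ psi p q ((z.appr n : ℕ) : ℤ_[p]) - psi p q z := by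
      induction n generalizing z with
      | zero => simp
      | succ n ih =>
        obtain ⟨w, j, rfl⟩ := aux_exists z
        obtain ⟨c, hc⟩ := ih w
        refine ⟨c, ?_⟩
        rw [aux_appr_step, Nat.cast_add, Nat.cast_mul, aux_psi_step, aux_psi_step]
        linear_combination (q : ℤ_[q]) * hc
    obtain ⟨c, hc⟩ := key
    rw [hc, norm_mul, norm_pow]
    exact mul_le_of_le_one_right (by positivity) (PadicInt.norm_le_one _)
  · by_contra! hlt
    have hp : 1 < p := (Fact.out : p.Prime).one_lt
    have h1 := aux_psi_lt p q q hlt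
    have h2 := aux_psi_step p q 1 ⟨0, by omega⟩
    have h3 := aux_psi_lt p q 1 hp
    simp only [Nat.cast_one] at h3
    simp only [Nat.cast_zero, add_zero, mul_one, zero_add, h3] at h2
    have h4 : (q : ℤ_[p]) = p := h (h1.trans h2.symm)
    have h5 : q = p := Nat.cast_injective h4
    omega
  · exact Function.LeftInverse.injective (g := psi q p) (aux_comp h)
  · by_contra! hlt
    obtain ⟨x, hx⟩ := h (p : ℤ_[q])
    obtain ⟨z, j, rfl⟩ := aux_exists x
    rw [aux_psi_step] at hx
    have hj := j.2
    have e1 := aux_appr_unique (p := q) (p : ℤ_[q]) 1 p (by simpa using hlt) (by simp)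
    have e2 := aux_appr_unique (p := q) (p : ℤ_[q]) 1 j (by simpa using hj.trans hlt)
      (Ideal.mem_span_singleton.2 ⟨psi p q z, by linear_combination -hx⟩)
    omega
  · exact Function.RightInverse.surjective (g := psi q p) (aux_comp h)
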